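/- For even n ≥ 6, the number of binary partial words of length n with exactly one hole, located at a position i with 0 ≤ i ≤ n/2 − 1, whose first non-hole character is 0, whose first half (positions 0 through n/2 − 1) contains exactly one occurrence of the letter 1, and whose minimal abelian border length equals n−1, is (n/2 − 2)·(2^{n/2 − 2}·(n/2 − 3) + 1). -/

import Mathlib

/-- A partial word over alphabet `α` is a list over `Option α`; `none` is a hole. -/
abbrev PWord (α : Type*) := List (Option α)

/-- `c` is a completion of the partial word `w`: a total word of the same length
agreeing with `w` on every non-hole position. -/
def IsCompletion {α : Type*} (w : PWord α) (c : List α) : Prop :=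
  List.Forall₂ (fun o a => ∀ x, o = some x → x = a) w c

/-- Two partial words are abelian compatible if they admit completions that are
permutations of one another (abelian equivalent). -/
def AbelianCompat {α : Type*} (u v : PWord α) : Prop :=
  ∃ cu cv, IsCompletion u cu ∧ IsCompletion v cv ∧ cu.Perm cv

/-- A partial word `w` has an abelian border of length `k`, `1 ≤ k ≤ |w| - 1`, if
its prefix of length `k` is abelian compatible with its suffix of length `k`. -/
def HasAbelianBorder {α : Type*} (w : PWord α) (k : ℕ) : Prop :=
  1 ≤ k ∧ k ≤ w.length - 1 ∧ AbelianCompat (w.take k) (w.drop (w.length - k))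

/-- A total word `w` has an abelian border of length `k`, `1 ≤ k ≤ |w| - 1`, if
its prefix of length `k` is a permutation of its suffix of length `k`. -/
def HasAbelianBorderT {α : Type*} (w : List α) (k : ℕ) : Prop :=
  1 ≤ k ∧ k ≤ w.length - 1 ∧ (w.take k).Perm (w.drop (w.length - k))

/-- The first non-hole character of the binary partial word `w` is the letter `0`:
some position `j` holds the letter `0` and all earlier positions are holes. -/
def FirstLetterIsZero (w : PWord (Fin 2)) : Prop :=
  ∃ j, (∀ l, l < j → w.getD l none = none) ∧ w.getD j none = some 0

theorem exists_isCompletion_count_iff (u : PWord (Fin 2)) (t : ℕ) :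
    (∃ c, IsCompletion u c ∧ c.count 1 = t) ↔
      u.countP (· = some 1) ≤ t ∧ t ≤ u.countP (· = some 1) + u.countP (·.isNone) := by
  induction u generalizing t with
  | nil =>
    simp only [IsCompletion, List.forall₂_nil_left_iff]
    simp [eq_comm]
  | cons o u ih =>
    have key : (∃ c, IsCompletion (o :: u) c ∧ c.count 1 = t) ↔
        ∃ a : Fin 2, (∀ x, o = some x → x = a) ∧
          ∃ c, IsCompletion u c ∧ c.count 1 + (if a = 1 then 1 else 0) = t := by
      simp only [IsCompletion, List.forall₂_cons_left_iff]
      constructor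
      · rintro ⟨_, ⟨a, c, ha, hc, rfl⟩, h⟩
        exact ⟨a, ha, c, hc, by simpa [List.count_cons] using h⟩
      · rintro ⟨a, ha, c, hc, h⟩
        exact ⟨_, ⟨a, c, ha, hc, rfl⟩, by simpa [List.count_cons] using h⟩
    rw [key]
    have shift : (∃ c, IsCompletion u c ∧ c.count 1 + 1 = t) ↔
        1 ≤ t ∧ ∃ c, IsCompletion u c ∧ c.count 1 = t - 1 := by
      constructor
      · rintro ⟨c, hc, rfl⟩
        exact ⟨by omega, c, hc, by omega⟩
      · rintro ⟨ht, c, hc, h⟩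
        exact ⟨c, hc, by omega⟩
    rcases o with _ | a
    · simp [Fin.exists_fin_two, shift, ih]
      omega
    · fin_cases a
      · simp [ih]
      · simp [shift, ih]
        omega

theorem perm_iff_count_one {a b : List (Fin 2)} (h : a.length = b.length) :
    a.Perm b ↔ a.count 1 = b.count 1 := by
  have hlen : ∀ l : List (Fin 2), l.count 0 + l.count 1 = l.length := by
    intro l
    induction l with
    | nil => rfl
    | cons x l ih =>
      fin_cases x <;> simp [← ih] <;> omega
  rw [List.perm_iff_count, Fin.forall_fin_two]
  have := hlen a
  have := hlen b
  omega

theorem abelianCompat_iff {u v : PWord (Fin 2)} (h : u.length = v.length) :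
    AbelianCompat u v ↔
      u.countP (· = some 1) ≤ v.countP (· = some 1) + v.countP (·.isNone) ∧
      v.countP (· = some 1) ≤ u.countP (· = some 1) + u.countP (·.isNone) := by
  have key : AbelianCompat u v ↔ ∃ t, (∃ c, IsCompletion u c ∧ c.count 1 = t) ∧
      ∃ c, IsCompletion v c ∧ c.count 1 = t := by
    constructor
    · rintro ⟨a, b, ha, hb, hp⟩
      exact ⟨_, ⟨a, ha, rfl⟩, b, hb, (hp.count_eq 1).symm⟩
    · rintro ⟨t, ⟨a, ha, hat⟩, b, hb, hbt⟩
      refine ⟨a, b, ha, hb, (perm_iff_count_one ?_).2 (hat.trans hbt.symm)⟩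
      rw [← List.Forall₂.length_eq ha, ← List.Forall₂.length_eq hb, h]
  simp only [key, exists_isCompletion_count_iff]
  constructor
  · rintro ⟨t, h₁, h₂⟩
    omega
  · intro h
    exact ⟨max (u.countP (· = some 1)) (v.countP (· = some 1)), by omega, by omega⟩

theorem countP_take_eq_count {α : Type*} (p : α → Bool) (w : List α) (d : α) {k : ℕ}
    (hk : k ≤ w.length) :
    (w.take k).countP p = Nat.count (fun x => p (w.getD x d)) k := by
  induction k with
  | zero => simp
  | succ k ih =>
    have hk' : k < w.length := by omega
    rw [List.take_add_one, List.countP_append, ih (by omega), Nat.count_succ]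
    simp [List.getElem?_eq_getElem hk', List.countP_cons]

theorem countP_drop_eq_count {α : Type*} (p : α → Bool) (w : List α) (d : α) {k : ℕ}
    (hk : k ≤ w.length) :
    (w.drop (w.length - k)).countP p =
      Nat.count (fun x => p (w.getD (w.length - 1 - x) d)) k := by
  have h := countP_take_eq_count p w.reverse d (k := k) (by simpa using hk)
  rw [List.take_reverse, List.countP_reverse] at h
  rw [h]
  simp only [Nat.count_eq_card_filter_range]
  congr 1
  refine Finset.filter_congr fun x hx => ?_
  have hx' : x < w.length := (Finset.mem_range.1 hx).trans_le hk
  simp [List.getElem?_reverse hx']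

theorem count_eq_ite {p : ℕ → Prop} [DecidablePred p] {i n : ℕ}
    (h : ∀ x < n, p x ↔ x = i) {k : ℕ} (hk : k ≤ n) :
    Nat.count p k = if i < k then 1 else 0 := by
  induction k with
  | zero => simp
  | succ k ih =>
    rw [Nat.count_succ, ih (by omega)]
    simp only [h k (by omega)]
    split_ifs <;> omega

theorem count_eq_one_iff {p : ℕ → Prop} [DecidablePred p] {n : ℕ} :
    Nat.count p n = 1 ↔ ∃ i < n, ∀ x < n, p x ↔ x = i := by
  constructor
  · rw [Nat.count_eq_card_filter_range, Finset.card_eq_one]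
    rintro ⟨i, hi⟩
    have hmem := fun x => congrArg (x ∈ ·) hi
    simp only [Finset.mem_filter, Finset.mem_range, Finset.mem_singleton, eq_iff_iff] at hmem
    exact ⟨i, ((hmem i).2 rfl).1, fun x hx => ⟨fun h => (hmem x).1 ⟨hx, h⟩,
      fun h => ((hmem x).2 h).2⟩⟩
  · rintro ⟨i, hi, h⟩
    rw [count_eq_ite h le_rfl, if_pos hi]

theorem hasAbelianBorder_iff {w : PWord (Fin 2)} {k : ℕ} (h1 : 1 ≤ k) (hk : k ≤ w.length - 1) :
    HasAbelianBorder w k ↔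
      (w.take k).countP (· = some 1) ≤ (w.drop (w.length - k)).countP (· = some 1) +
        (w.drop (w.length - k)).countP (·.isNone) ∧
      (w.drop (w.length - k)).countP (· = some 1) ≤ (w.take k).countP (· = some 1) +
        (w.take k).countP (·.isNone) := by
  rw [HasAbelianBorder, abelianCompat_iff (by simp; omega)]
  tauto

theorem minimal_border_iff {w : PWord (Fin 2)} {m i j : ℕ} (hm : 3 ≤ m)
    (hw : w.length = 2 * m) (hi : i < m) (hj : j < m)
    (hole : ∀ x < 2 * m, w.getD x none = none ↔ x = i)
    (one : ∀ x < m, w.getD x none = some 1 ↔ x = j) :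
    (FirstLetterIsZero w ∧ IsLeast {k | HasAbelianBorder w k} (2 * m - 1)) ↔
      1 ≤ i ∧ 2 ≤ j ∧ w.getD (2 * m - 1) none = some 1 ∧ w.getD (2 * m - 2) none = some 1 ∧
        ∃ r, 2 ≤ r ∧ r ≤ j ∧ w.getD (2 * m - 1 - r) none = some 1 := by
  set c : ℕ → ℕ := Nat.count fun x => w.getD (2 * m - 1 - x) none = some 1 with hc
  have hcs : ∀ k, c (k + 1) = c k + if w.getD (2 * m - 1 - k) none = some 1 then 1 else 0 :=
    fun k => Nat.count_succ _ k
  have hmono : Monotone c := Nat.count_monotone _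
  have c0 : c 0 = 0 := Nat.count_zero _
  have hP : ∀ k ≤ m, (w.take k).countP (· = some 1) = if j < k then 1 else 0 := by
    intro k hk
    rw [countP_take_eq_count _ _ none (by omega)]
    exact count_eq_ite (by simpa using one) hk
  have hH : ∀ k ≤ 2 * m, (w.take k).countP (·.isNone) = if i < k then 1 else 0 := by
    intro k hk
    rw [countP_take_eq_count _ _ none (by omega)]
    exact count_eq_ite (by simpa using hole) hk
  have hC : ∀ k ≤ 2 * m, (w.drop (2 * m - k)).countP (· = some 1) = c k := by
    intro k hk
    rw [← hw, countP_drop_eq_count _ _ none (by omega), hc]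
    simp [hw]
  clear_value c
  have hsplit : ∀ (p : Option (Fin 2) → Bool) k,
      (w.take k).countP p + (w.drop k).countP p = w.countP p := by
    intro p k
    rw [← List.countP_append, List.take_append_drop]
  have htot : w.countP (·.isNone) = 1 := by
    have := hH (2 * m) le_rfl
    rwa [← hw, List.take_length, hw, if_pos (by omega)] at this
  have border : ∀ k, 1 ≤ k → k ≤ m → (HasAbelianBorder w k ↔
      (if j < k then 1 else 0) ≤ c k ∧
      c k ≤ (if j < k then 1 else 0) + (if i < k then 1 else 0)) := by
    intro k h1 hk
    rw [hasAbelianBorder_iff h1 (by omega), hw, hP k hk, hC k (by omega), hH k (by omega)]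
    have := hsplit (·.isNone) (2 * m - k)
    rw [hH _ (by omega), htot, if_pos (by omega)] at this
    omega
  have coborder : ∀ k, 1 ≤ k → k < m → (HasAbelianBorder w (2 * m - k) ↔
      (if j < k then 1 else 0) + (if i < k then 1 else 0) ≤ c k + 1 ∧
      c k ≤ (if j < k then 1 else 0) + 1) := by
    intro k h1 hk
    rw [hasAbelianBorder_iff (by omega) (by omega), hw,
      show 2 * m - (2 * m - k) = k by omega, hH (2 * m - k) (by omega), if_pos (by omega)]
    have h₁ := hsplit (·.isNone) k
    have h₂ := hsplit (· = some 1) k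
    have h₃ := hsplit (· = some 1) (2 * m - k)
    rw [hH _ (by omega), htot] at h₁
    rw [hP k (by omega)] at h₂
    rw [hC k (by omega)] at h₃
    omega
  have c1 : c 1 = c 0 + if w.getD (2 * m - 1 - 0) none = some 1 then 1 else 0 := hcs 0
  have c2 : c 2 = c 1 + if w.getD (2 * m - 1 - 1) none = some 1 then 1 else 0 := hcs 1
  have hlast : w.getD (2 * m - 1) none = some 1 ∧ w.getD (2 * m - 2) none = some 1 ↔
      c 2 = 2 := by
    simp only [c0, Nat.sub_zero, zero_add] at c1 c2
    rw [show 2 * m - 1 - 1 = 2 * m - 2 by omega] at c2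
    split_ifs at c1 c2 <;> simp_all
  have hextra : c 2 = 2 → 2 ≤ j → ((∃ r, 2 ≤ r ∧ r ≤ j ∧
      w.getD (2 * m - 1 - r) none = some 1) ↔ 3 ≤ c (j + 1)) := by
    intro h2 hj2
    constructor
    · rintro ⟨r, hr2, hrj, hr⟩
      have h₁ := hcs r
      rw [if_pos hr] at h₁
      have h₂ : c 2 ≤ c r := hmono hr2
      have h₃ : c (r + 1) ≤ c (j + 1) := hmono (by omega)
      omega
    · intro h3
      by_contra! hno
      have : ∀ k, 2 ≤ k → k ≤ j + 1 → c k = 2 := by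
        intro k hk
        induction k, hk using Nat.le_induction with
        | base => exact fun _ => h2
        | succ k hk ih =>
          intro hkj
          rw [hcs, ih (by omega), if_neg (hno k hk (by omega))]
      have := this (j + 1) (by omega) le_rfl
      omega
  have c1le : c 1 ≤ 1 := by
    split_ifs at c1 <;> omega
  have c2le : c 2 ≤ c 1 + 1 := by
    rw [c2]
    split_ifs <;> omega
  clear c1 c2
  have hrhs : (1 ≤ i ∧ 2 ≤ j ∧ w.getD (2 * m - 1) none = some 1 ∧
      w.getD (2 * m - 2) none = some 1 ∧
        ∃ r, 2 ≤ r ∧ r ≤ j ∧ w.getD (2 * m - 1 - r) none = some 1) ↔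
      1 ≤ i ∧ 2 ≤ j ∧ c 2 = 2 ∧ 3 ≤ c (j + 1) := by
    rw [← and_assoc (a := _ = _), hlast]
    constructor
    · rintro ⟨h1, h2, h3, h4⟩
      exact ⟨h1, h2, h3, (hextra h3 h2).1 h4⟩
    · rintro ⟨h1, h2, h3, h4⟩
      exact ⟨h1, h2, h3, (hextra h3 h2).2 h4⟩
  rw [hrhs]
  constructor
  · rintro ⟨⟨z, hz, hz0⟩, -, hleast⟩
    have hno : ∀ k < 2 * m - 1, ¬ HasAbelianBorder w k := fun k hk h => by
      have := hleast h
      omega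
    have hj0 : j ≠ 0 := by
      rintro rfl
      have h0 := (one 0 (by omega)).2 rfl
      rcases Nat.eq_zero_or_pos z with rfl | hzp
      · rw [hz0] at h0
        simp at h0
      · rw [hz 0 hzp] at h0
        simp at h0
    have hcj : c 2 ≤ c (j + 1) := hmono (by omega)
    have hc12 : c 1 ≤ c 2 := hmono (by omega)
    have hi1 : 1 ≤ i ∧ c 1 = 1 := by
      have b := (border 1 le_rfl (by omega)).not.1 (hno 1 (by omega))
      rw [if_neg (by omega)] at b
      split_ifs at b <;> omega
    have hj2 : 2 ≤ j ∧ c 2 = 2 := by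
      have b := (coborder 2 (by omega) (by omega)).not.1 (hno _ (by omega))
      split_ifs at b <;> omega
    refine ⟨hi1.1, hj2.1, hj2.2, ?_⟩
    by_cases hjm : j + 1 < m
    · have b := (coborder (j + 1) (by omega) hjm).not.1 (hno _ (by omega))
      rw [if_pos (by omega)] at b
      split_ifs at b <;> omega
    · have b := (border (j + 1) (by omega) (by omega)).not.1 (hno _ (by omega))
      rw [if_pos (by omega), if_pos (by omega)] at b
      omega
  · rintro ⟨h1, h2, h3, h4⟩
    have hbig : ∀ k, 2 ≤ k → k ≤ m → (if j < k then 1 else 0) + 1 < c k := by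
      intro k hk2 hkm
      have : c 2 ≤ c k := hmono hk2
      split_ifs with hjk
      · have : c (j + 1) ≤ c k := hmono hjk
        omega
      · omega
    refine ⟨⟨0, by simp, ?_⟩, ?_, ?_⟩
    · have h₁ := (hole 0 (by omega)).not.2 (by omega)
      have h₂ := (one 0 (by omega)).not.2 (by omega)
      generalize w.getD 0 none = o at h₁ h₂
      rcases o with _ | a
      · exact absurd rfl h₁
      · fin_cases a
        · rfl
        · exact absurd rfl h₂
    · refine (coborder 1 le_rfl (by omega)).2 ?_
      split_ifs <;> omega
    · intro k hk
      by_contra! hlt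
      have hk1 : 1 ≤ k := hk.1
      rcases le_or_gt k m with hkm | hkm
      · have hb := (border k hk1 hkm).1 hk
        rcases eq_or_lt_of_le hk1 with rfl | hk2
        · split_ifs at hb <;> omega
        · have := hbig k hk2 hkm
          split_ifs at hb this <;> omega
      · obtain ⟨k', rfl⟩ : ∃ k', k = 2 * m - k' := ⟨2 * m - k, by omega⟩
        have hb := (coborder k' (by omega) (by omega)).1 hk
        have := hbig k' (by omega) (by omega)
        omega

theorem existsUnique_hole_iff {w : PWord (Fin 2)} {m : ℕ} (hm : 0 < m) (hw : w.length = 2 * m) :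
    (w.countP (·.isNone) = 1 ∧ ∃ i, i ≤ m - 1 ∧ w.getD i (some 0) = none) ↔
      ∃ i < m, ∀ x < 2 * m, w.getD x none = none ↔ x = i := by
  have hcount := countP_take_eq_count (·.isNone) w none (le_refl w.length)
  have hgetD : ∀ x < 2 * m, w.getD x (some 0) = w.getD x none := fun x hx => by
    rw [List.getD_eq_getElem _ _ (by omega), List.getD_eq_getElem _ _ (by omega)]
  rw [List.take_length, hw] at hcount
  rw [hcount, count_eq_one_iff]
  simp only [Option.isNone_iff_eq_none]
  constructor
  · rintro ⟨⟨i, -, hi⟩, i', hi', h⟩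
    rw [hgetD i' (by omega), hi i' (by omega)] at h
    exact ⟨i, by omega, hi⟩
  · rintro ⟨i, him, hi⟩
    refine ⟨⟨i, by omega, hi⟩, i, by omega, ?_⟩
    rw [hgetD i (by omega), hi i (by omega)]

theorem count_take_eq_one_iff {w : PWord (Fin 2)} {m : ℕ} (hw : m ≤ w.length) :
    (w.take m).count (some 1) = 1 ↔ ∃ j < m, ∀ x < m, w.getD x none = some 1 ↔ x = j := by
  rw [List.count, countP_take_eq_count _ w none hw, count_eq_one_iff]
  simp only [beq_iff_eq]

/-- The word of length `2 * m` with a hole at `i`, whose first half has its only `1` at `j`, and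
whose second half, read backwards, has its `1`s at `0`, `1` and the elements of `S`. -/
def borderWord (m i j : ℕ) (S : Finset ℕ) : PWord (Fin 2) :=
  (List.range (2 * m)).map fun x =>
    if x = i then none else if x = j then some 1 else if x < m then some 0 else
      if 2 * m - 1 - x < 2 ∨ 2 * m - 1 - x ∈ S then some 1 else some 0

theorem length_borderWord (m i j : ℕ) (S : Finset ℕ) : (borderWord m i j S).length = 2 * m := by
  simp [borderWord]

theorem getD_borderWord {m i j x : ℕ} {S : Finset ℕ} (hx : x < 2 * m) :
    (borderWord m i j S).getD x none =
      if x = i then none else if x = j then some 1 else if x < m then some 0 else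
        if 2 * m - 1 - x < 2 ∨ 2 * m - 1 - x ∈ S then some 1 else some 0 := by
  rw [List.getD_eq_getElem _ _ (by rwa [length_borderWord])]
  simp [borderWord]

theorem getD_borderWord_eq_none {m i j x : ℕ} {S : Finset ℕ} (hx : x < 2 * m) :
    (borderWord m i j S).getD x none = none ↔ x = i := by
  rw [getD_borderWord hx]
  split_ifs <;> simp_all

theorem getD_borderWord_eq_one {m i j x : ℕ} {S : Finset ℕ} (hij : i ≠ j) (hx : x < m) :
    (borderWord m i j S).getD x none = some 1 ↔ x = j := by
  rw [getD_borderWord (by omega)]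
  split_ifs <;> simp_all

theorem getD_borderWord_reverse {m i j r : ℕ} {S : Finset ℕ} (hi : i < m) (hj : j < m)
    (hr : r < m) :
    (borderWord m i j S).getD (2 * m - 1 - r) none = some 1 ↔ r < 2 ∨ r ∈ S := by
  rw [getD_borderWord (by omega), if_neg (by omega), if_neg (by omega), if_neg (by omega),
    show 2 * m - 1 - (2 * m - 1 - r) = r by omega]
  split_ifs <;> simp_all

theorem eq_borderWord {w : PWord (Fin 2)} {m i j : ℕ} (hw : w.length = 2 * m)
    (hi : i < m) (hj : j < m)
    (hole : ∀ x < 2 * m, w.getD x none = none ↔ x = i)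
    (one : ∀ x < m, w.getD x none = some 1 ↔ x = j)
    (last : w.getD (2 * m - 1) none = some 1) (last' : w.getD (2 * m - 2) none = some 1) :
    borderWord m i j
      ((Finset.Ico 2 m).filter fun r => w.getD (2 * m - 1 - r) none = some 1) = w := by
  refine List.ext_getElem (by rw [length_borderWord, hw]) fun x h₁ h₂ => ?_
  have hx : x < 2 * m := by omega
  rw [← List.getD_eq_getElem _ none h₁, ← List.getD_eq_getElem _ none h₂, getD_borderWord hx]
  have binary : ∀ o : Option (Fin 2), o ≠ none → o ≠ some 1 → some 0 = o := by decide
  have hhole := hole x hx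
  split_ifs with hxi hxj hxm hxS
  · exact (hhole.2 hxi).symm
  · exact ((one x (by omega)).2 hxj).symm
  · exact binary _ (hhole.not.2 hxi) ((one x hxm).not.2 hxj)
  · rcases hxS with hx2 | hxS
    · obtain rfl | rfl : x = 2 * m - 1 ∨ x = 2 * m - 2 := by omega
      · exact last.symm
      · exact last'.symm
    · have := (Finset.mem_filter.1 hxS).2
      rw [show 2 * m - 1 - (2 * m - 1 - x) = x by omega] at this
      exact this.symm
  · refine binary _ (hhole.not.2 hxi) fun h => hxS ?_
    by_cases hx2 : 2 * m - 1 - x < 2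
    · exact Or.inl hx2
    · refine Or.inr (Finset.mem_filter.2 ⟨Finset.mem_Ico.2 (by omega), ?_⟩)
      rwa [show 2 * m - 1 - (2 * m - 1 - x) = x by omega]

/-- The parameters `⟨j, i, S⟩` for which `borderWord m i j S` starts with the letter `0` and has
minimal abelian border length `2 * m - 1`. -/
def borderParams (m : ℕ) : Finset (Σ _ : ℕ, ℕ × Finset ℕ) :=
  (Finset.Ico 2 m).sigma fun j =>
    ((Finset.Ico 1 m).erase j) ×ˢ
      ((Finset.Ico 2 m).powerset \ (Finset.Ico (j + 1) m).powerset)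

theorem mem_borderParams {m i j : ℕ} {S : Finset ℕ} :
    ⟨j, i, S⟩ ∈ borderParams m ↔ (2 ≤ j ∧ j < m) ∧ (i ≠ j ∧ 1 ≤ i ∧ i < m) ∧
      S ⊆ Finset.Ico 2 m ∧ ∃ r, 2 ≤ r ∧ r ≤ j ∧ r ∈ S := by
  simp only [borderParams, Finset.mem_sigma, Finset.mem_product, Finset.mem_erase, Finset.mem_Ico,
    Finset.mem_sdiff, Finset.mem_powerset]
  refine and_congr_right fun hj => and_congr_right fun _ => and_congr_right fun hS => ?_
  rw [Finset.not_subset]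
  constructor
  · rintro ⟨r, hr, hrj⟩
    have := Finset.mem_Ico.1 (hS hr)
    rw [Finset.mem_Ico] at hrj
    exact ⟨r, by omega, by omega, hr⟩
  · rintro ⟨r, -, hrj, hr⟩
    exact ⟨r, hr, by rw [Finset.mem_Ico]; omega⟩

theorem card_borderParams {m : ℕ} (hm : 3 ≤ m) :
    (borderParams m).card = (m - 2) * (2 ^ (m - 2) * (m - 3) + 1) := by
  have hcard : ∀ j ∈ Finset.Ico 2 m,
      (((Finset.Ico 1 m).erase j) ×ˢ
        ((Finset.Ico 2 m).powerset \ (Finset.Ico (j + 1) m).powerset)).card =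
      (m - 2) * (2 ^ (m - 2) - 2 ^ (m - 1 - j)) := by
    intro j hj
    rw [Finset.mem_Ico] at hj
    rw [Finset.card_product, Finset.card_erase_of_mem (Finset.mem_Ico.2 (by omega)),
      Finset.card_sdiff_of_subset
        (Finset.powerset_mono.2 (Finset.Ico_subset_Ico_left (by omega))),
      Finset.card_powerset, Finset.card_powerset, Nat.card_Ico, Nat.card_Ico, Nat.card_Ico,
      Nat.sub_sub m 1 1, Nat.sub_sub m 1 j, add_comm 1 j]
  rw [borderParams, Finset.card_sigma, Finset.sum_congr rfl hcard, ← Finset.mul_sum]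
  congr 1
  obtain ⟨p, rfl⟩ : ∃ p, m = p + 3 := ⟨m - 3, by omega⟩
  rw [Finset.sum_Ico_eq_sum_range, ← Finset.sum_range_reflect]
  have hsum : ∀ x ∈ Finset.range (p + 3 - 2),
      2 ^ (p + 3 - 2) - 2 ^ (p + 3 - 1 - (2 + (p + 3 - 2 - 1 - x))) = 2 ^ (p + 1) - 2 ^ x := by
    intro x hx
    rw [Finset.mem_range] at hx
    congr 2
    omega
  rw [Finset.sum_congr rfl hsum, Finset.sum_tsub_distrib _ fun x hx =>
    Nat.pow_le_pow_right two_pos (by rw [Finset.mem_range] at hx; omega)]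
  rw [show p + 3 - 2 = p + 1 by omega, show p + 3 - 3 = p by omega, Nat.geomSum_eq le_rfl]
  simp only [Finset.sum_const, Finset.card_range, smul_eq_mul, Nat.reduceSub, Nat.div_one]
  have := Nat.one_le_two_pow (n := p + 1)
  rw [add_mul, one_mul, mul_comm p]
  omega

theorem injOn_borderWord (m : ℕ) :
    Set.InjOn (fun t : Σ _ : ℕ, ℕ × Finset ℕ => borderWord m t.2.1 t.1 t.2.2)
      (borderParams m) := by
  rintro ⟨j, i, S⟩ h ⟨j', i', S'⟩ h' heq
  rw [Finset.mem_coe, mem_borderParams] at h h'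
  obtain ⟨hj, ⟨hij, hi⟩, hS, -⟩ := h
  obtain ⟨hj', ⟨hij', hi'⟩, hS', -⟩ := h'
  simp only at heq
  obtain rfl : i = i' := by
    have := (getD_borderWord_eq_none (j := j) (S := S) (show i < 2 * m by omega)).2 rfl
    rwa [heq, getD_borderWord_eq_none (by omega)] at this
  obtain rfl : j = j' := by
    have := (getD_borderWord_eq_one (S := S) hij hj.2).2 rfl
    rwa [heq, getD_borderWord_eq_one hij' hj.2] at this
  obtain rfl : S = S' := by
    ext r
    by_cases hr : r ∈ Finset.Ico 2 m
    · rw [Finset.mem_Ico] at hr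
      have := getD_borderWord_reverse (S := S) hi.2 hj.2 hr.2
      rw [heq, getD_borderWord_reverse hi.2 hj.2 hr.2] at this
      simpa [show ¬ r < 2 by omega] using this.symm
    · exact iff_of_false (fun h => hr (hS h)) (fun h => hr (hS' h))
  rfl

theorem mem_image_borderWord_iff {m : ℕ} (hm : 3 ≤ m) (w : PWord (Fin 2)) :
    w ∈ (borderParams m).image (fun t => borderWord m t.2.1 t.1 t.2.2) ↔
      w.length = 2 * m ∧ w.countP (·.isNone) = 1 ∧
        (∃ i, i ≤ m - 1 ∧ w.getD i (some 0) = none) ∧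
        FirstLetterIsZero w ∧
        (w.take m).count (some 1) = 1 ∧
        IsLeast {k | HasAbelianBorder w k} (2 * m - 1) := by
  rw [Finset.mem_image]
  constructor
  · rintro ⟨⟨j, i, S⟩, ht, rfl⟩
    obtain ⟨hj, ⟨hij, hi⟩, hS, r, hr2, hrj, hr⟩ := mem_borderParams.1 ht
    have hw := length_borderWord m i j S
    have hole := fun x (hx : x < 2 * m) => getD_borderWord_eq_none (i := i) (j := j) (S := S) hx
    have one := fun x (hx : x < m) => getD_borderWord_eq_one (S := S) hij hx
    have hrev := fun r (hr : r < m) => getD_borderWord_reverse (S := S) hi.2 hj.2 hr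
    obtain ⟨h₁, h₂⟩ := (existsUnique_hole_iff (by omega) hw).2 ⟨i, hi.2, hole⟩
    obtain ⟨h₃, h₄⟩ := (minimal_border_iff hm hw hi.2 hj.2 hole one).2
      ⟨hi.1, hj.1, (hrev 0 (by omega)).2 (by simp), (hrev 1 (by omega)).2 (by simp),
        r, hr2, hrj, (hrev r (by omega)).2 (Or.inr hr)⟩
    exact ⟨hw, h₁, h₂, h₃,
      (count_take_eq_one_iff (by simp only [length_borderWord]; omega)).2 ⟨j, hj.2, one⟩, h₄⟩
  · rintro ⟨hw, h₁, h₂, h₃, h₄, h₅⟩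
    obtain ⟨i, hi, hole⟩ := (existsUnique_hole_iff (by omega) hw).1 ⟨h₁, h₂⟩
    obtain ⟨j, hj, one⟩ := (count_take_eq_one_iff (by omega)).1 h₄
    obtain ⟨hi1, hj2, last, last', r, hr2, hrj, hr⟩ :=
      (minimal_border_iff hm hw hi hj hole one).1 ⟨h₃, h₅⟩
    have hij : i ≠ j := by
      rintro rfl
      have := (one i hi).2 rfl
      rw [(hole i (by omega)).2 rfl] at this
      simp at this
    refine ⟨⟨j, i, _⟩, mem_borderParams.2 ⟨⟨hj2, hj⟩, ⟨hij, hi1, hi⟩, Finset.filter_subset _ _,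
      r, hr2, hrj, Finset.mem_filter.2 ⟨Finset.mem_Ico.2 (by omega), hr⟩⟩,
      eq_borderWord hw hi hj hole one last last'⟩

/-- For even `n ≥ 6`, the number of binary partial words of length `n` with exactly
one hole located at a position `i ≤ n/2 - 1`, whose first non-hole character is `0`,
with exactly one occurrence of the letter `1` in the first half, and with minimal
abelian border length `n - 1`, is `(n/2 - 2) * (2^(n/2 - 2) * (n/2 - 3) + 1)`. -/
theorem stmt_17 (n : ℕ) (hn : 6 ≤ n) (he : Even n) :
    Nat.card {w : PWord (Fin 2) // w.length = n ∧ w.countP (·.isNone) = 1 ∧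
        (∃ i, i ≤ n / 2 - 1 ∧ w.getD i (some 0) = none) ∧
        FirstLetterIsZero w ∧
        (w.take (n / 2)).count (some 1) = 1 ∧
        IsLeast {k | HasAbelianBorder w k} (n - 1)} =
      (n / 2 - 2) * (2 ^ (n / 2 - 2) * (n / 2 - 3) + 1) := by
  obtain ⟨m, rfl⟩ := even_iff_exists_two_mul.1 he
  rw [Nat.mul_div_cancel_left m two_pos]
  rw [Nat.subtype_card _ (mem_image_borderWord_iff (by omega)),
    Finset.card_image_of_injOn (injOn_borderWord m), card_borderParams (by omega)]
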